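/- arXiv:1101.3837 — 6 statements merged into one kernel-verified Lean document; each statement's English description precedes it below -/
import Mathlib

section
/- Let k be a positive integer and N = 2^k, and let U be the 2×2 real rotation matrix by angle θ = π/(2N), i.e. U = ![![cos θ, −sin θ], ![sin θ, cos θ]]. Then for every nonnegative integer i, the squared modulus of the first component of U^(i·N) applied to the unit vector e₁ = (1,0)ᵀ equals 1 if i is even and equals 0 if i is odd. (Equivalently: the two-state Moore–Crutchfield quantum finite automaton whose letter transition is U accepts every string a^(i·2^k) with i even with probability exactly 1, and accepts every string a^(i·2^k) with i odd with probability exactly 0, i.e. it solves the promise problem A^k exactly.) -/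
open Real Matrix

/-- The `n`-th power of the plane rotation by `θ` is the rotation by `n * θ`. -/
theorem rotation_pow (θ : ℝ) (n : ℕ) :
    !![Real.cos θ, -Real.sin θ; Real.sin θ, Real.cos θ] ^ n =
      !![Real.cos (n * θ), -Real.sin (n * θ); Real.sin (n * θ), Real.cos (n * θ)] := by
  induction n with
  | zero => simp [Matrix.one_fin_two]
  | succ n ih =>
    rw [pow_succ, ih, Nat.cast_succ, add_mul, one_mul, Real.cos_add, Real.sin_add,
      Matrix.mul_fin_two]
    congr! 3 <;> ring_nf

/-- the two-state MCQFA with letter transition given by the rotation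
by angle `π / (2 * 2^k)` accepts `a^(i·2^k)` with probability exactly 1 when `i` is even
and exactly 0 when `i` is odd. -/
theorem mcqfa_solves_Ak_exactly
    (k : ℕ) (hk : 0 < k) (N : ℕ) (hN : N = 2 ^ k)
    (θ : ℝ) (hθ : θ = Real.pi / (2 * N))
    (U : Matrix (Fin 2) (Fin 2) ℝ)
    (hU : U = !![Real.cos θ, -Real.sin θ; Real.sin θ, Real.cos θ]) :
    ∀ i : ℕ, (((U ^ (i * N)).mulVec ![1, 0]) 0) ^ 2 = if Even i then 1 else 0 := by
  intro i
  have hN0 : (N : ℝ) ≠ 0 := by simp [hN]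
  have hangle : ((i * N : ℕ) : ℝ) * θ = i * (Real.pi / 2) := by
    rw [hθ]
    push_cast
    field_simp
  have hamp : ((U ^ (i * N)).mulVec ![1, 0]) 0 = Real.cos (i * (Real.pi / 2)) := by
    rw [hU, rotation_pow, hangle]
    simp [Matrix.mulVec, dotProduct]
  rw [hamp]
  split_ifs with h
  · obtain ⟨m, rfl⟩ := h
    have hm : ((m + m : ℕ) : ℝ) * (Real.pi / 2) = m * Real.pi := by
      push_cast
      ring
    rw [hm, Real.cos_nat_mul_pi, ← pow_mul, mul_comm, pow_mul]
    simp
  · obtain ⟨m, rfl⟩ := Nat.not_even_iff_odd.mp h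
    have hm : ((2 * m + 1 : ℕ) : ℝ) * (Real.pi / 2) = m * Real.pi + Real.pi / 2 := by
      push_cast
      ring
    rw [hm, Real.cos_add_pi_div_two, Real.sin_nat_mul_pi]
    simp
end

section
/- Let k be a positive integer. Every deterministic finite automaton over the one-letter alphabet that solves the promise problem A^k exactly has at least 2^(k+1) states. Formally: if σ is a finite type and M is a DFA over a one-element alphabet with state type σ such that for every nonnegative even integer i the word a^(i·2^k) (the list of i·2^k copies of the letter) is accepted by M, and for every positive odd integer i the word a^(i·2^k) is rejected by M, then the cardinality of σ is at least 2^(k+1). -/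
/-- Once two powers of the letter reach the same state, the run of a unary DFA is periodic. -/
theorem DFA.eval_replicate_add_mul {σ : Type*} (M : DFA Unit σ) {a p : ℕ}
    (h : M.eval (List.replicate (a + p) ()) = M.eval (List.replicate a ()))
    {n : ℕ} (hn : a ≤ n) (c : ℕ) :
    M.eval (List.replicate (n + c * p) ()) = M.eval (List.replicate n ()) := by
  have shift : ∀ m, a ≤ m →
      M.eval (List.replicate (m + p) ()) = M.eval (List.replicate m ()) := by
    intro m hm
    induction m, hm using Nat.le_induction with
    | base => exact h
    | succ m _ ih =>
      rw [Nat.add_right_comm, List.replicate_succ', List.replicate_succ',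
        DFA.eval_append_singleton, DFA.eval_append_singleton, ih]
  induction c with
  | zero => simp
  | succ c ih => rw [Nat.succ_mul, ← Nat.add_assoc, shift _ (by omega), ih]

/-- Some period of the run of a unary DFA is at most the number of its states. -/
theorem DFA.exists_eval_replicate_add_eq {σ : Type*} [Fintype σ] (M : DFA Unit σ) :
    ∃ a p : ℕ, 0 < p ∧ p ≤ Fintype.card σ ∧
      M.eval (List.replicate (a + p) ()) = M.eval (List.replicate a ()) := by
  obtain ⟨x, y, hxy, he⟩ := Fintype.exists_ne_map_eq_of_card_lt
    (fun i : Fin (Fintype.card σ + 1) => M.eval (List.replicate i.val ())) (by simp)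
  wlog hlt : x < y generalizing x y
  · exact this y x hxy.symm he.symm (lt_of_le_of_ne (not_lt.mp hlt) hxy.symm)
  have hlt' : x.val < y.val := hlt
  refine ⟨x, y - x, by omega, by omega, ?_⟩
  rw [Nat.add_sub_cancel' hlt'.le]
  exact he.symm

/-- any DFA over a one-letter alphabet solving the promise problem
`A^k` exactly has at least `2^(k+1)` states. -/
theorem dfa_solving_Ak_lower_bound
    (k : ℕ) (hk : 0 < k) (σ : Type) [Fintype σ] (M : DFA Unit σ)
    (h_yes : ∀ i : ℕ, Even i → List.replicate (i * 2 ^ k) () ∈ M.accepts)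
    (h_no : ∀ i : ℕ, Odd i → 0 < i → List.replicate (i * 2 ^ k) () ∉ M.accepts) :
    2 ^ (k + 1) ≤ Fintype.card σ := by
  obtain ⟨a, p, hp, hpc, h⟩ := M.exists_eval_replicate_add_eq
  refine le_trans ?_ hpc
  obtain ⟨j, t, ht, rfl⟩ := Nat.exists_eq_two_pow_mul_odd hp.ne'
  by_cases hj : j ≤ k
  · exfalso
    have hn : a ≤ 2 * a * 2 ^ k := by
      have := Nat.one_le_two_pow (n := k)
      nlinarith
    have key := M.eval_replicate_add_mul h hn (2 ^ (k - j))
    have hlen : 2 * a * 2 ^ k + 2 ^ (k - j) * (2 ^ j * t) = (2 * a + t) * 2 ^ k := by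
      rw [← mul_assoc, ← pow_add, Nat.sub_add_cancel hj]
      ring
    rw [hlen] at key
    have hodd : Odd (2 * a + t) := (even_two_mul a).add_odd ht
    apply h_no _ hodd hodd.pos
    rw [DFA.mem_accepts, key]
    exact h_yes _ (even_two_mul a)
  · calc 2 ^ (k + 1) ≤ 2 ^ j := Nat.pow_le_pow_right two_pos (by omega)
      _ ≤ 2 ^ j * t := Nat.le_mul_of_pos_right _ ht.pos
end

section
/- Let k be a positive integer. The minimal number of states of a deterministic finite automaton over the one-letter alphabet solving the promise problem A^k exactly is exactly 2^(k+1): there exists such a DFA with 2^(k+1) states, and every finite-state DFA solving A^k exactly has at least 2^(k+1) states. -/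
/-- A DFA over a one-letter alphabet reads a word by iterating its transition map. -/
theorem DFA.eval_replicate_unit {σ : Type*} (M : DFA Unit σ) (n : ℕ) :
    M.eval (List.replicate n ()) = (fun s => M.step s ())^[n] M.start := by
  induction n with
  | zero => rfl
  | succ n ih =>
    rw [List.replicate_succ', DFA.eval_append_singleton, ih, Function.iterate_succ_apply']

/-- Every orbit of a self-map of a finite type reaches a periodic point, whose period is at most
the cardinality of the type. -/
theorem Function.exists_isPeriodicPt_iterate {σ : Type*} [Fintype σ] (f : σ → σ) (s : σ) :
    ∃ a p, 0 < p ∧ p ≤ Fintype.card σ ∧ Function.IsPeriodicPt f p (f^[a] s) := by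
  obtain ⟨x, y, hne, hxy⟩ := Fintype.exists_ne_map_eq_of_card_lt
    (fun n : Fin (Fintype.card σ + 1) => f^[n] s) (by simp)
  wlog hlt : x < y generalizing x y
  · exact this y x hne.symm hxy.symm (lt_of_le_of_ne (not_lt.mp hlt) hne.symm)
  have hlt' : (x : ℕ) < y := hlt
  refine ⟨x, y - x, by omega, by omega, ?_⟩
  rw [Function.IsPeriodicPt, Function.IsFixedPt, ← Function.iterate_add_apply,
    Nat.sub_add_cancel hlt'.le]
  exact hxy.symm

/-- A positive number below `2 ^ (k + 1)` divides an odd multiple of `2 ^ k`. -/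
theorem Nat.exists_odd_mul_two_pow_of_lt {k p : ℕ} (hp : 0 < p) (hlt : p < 2 ^ (k + 1)) :
    ∃ m, Odd m ∧ p ∣ m * 2 ^ k := by
  obtain ⟨j, m, hm, rfl⟩ := Nat.exists_eq_two_pow_mul_odd hp.ne'
  have hj : j < k + 1 := (Nat.pow_lt_pow_iff_right one_lt_two).mp
    ((Nat.le_mul_of_pos_right _ hm.pos).trans_lt hlt)
  refine ⟨m, hm, ?_⟩
  rw [mul_comm]
  exact mul_dvd_mul_left m (pow_dvd_pow 2 (Nat.lt_succ_iff.mp hj))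

/-- The cyclic DFA with `n` states over a one-letter alphabet, accepting the words whose length is
divisible by `n`. -/
def cyclicDFA (n : ℕ) [NeZero n] : DFA Unit (Fin n) where
  step s _ := s + 1
  start := 0
  accept := {0}

theorem replicate_mem_accepts_cyclicDFA (n : ℕ) [NeZero n] (l : ℕ) :
    List.replicate l () ∈ (cyclicDFA n).accepts ↔ n ∣ l := by
  have h : (fun s : Fin n => s + 1)^[l] 0 = Fin.ofNat n l := by
    induction l with
    | zero => rfl
    | succ l ih =>
      rw [Function.iterate_succ_apply', ih]
      ext
      simp [Fin.val_add]
  rw [DFA.mem_accepts, DFA.eval_replicate_unit]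
  change (fun s : Fin n => s + 1)^[l] 0 = 0 ↔ _
  rw [h, Fin.ext_iff]
  simp [Nat.dvd_iff_mod_eq_zero]

/-- the minimal number of states of a DFA over a one-letter alphabet
solving the promise problem `A^k` exactly is exactly `2^(k+1)`. -/
theorem dfa_solving_Ak_minimal
    (k : ℕ) (hk : 0 < k) :
    (∃ M : DFA Unit (Fin (2 ^ (k + 1))),
      (∀ i : ℕ, Even i → List.replicate (i * 2 ^ k) () ∈ M.accepts) ∧
      (∀ i : ℕ, Odd i → 0 < i → List.replicate (i * 2 ^ k) () ∉ M.accepts)) ∧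
    (∀ (σ : Type) [Fintype σ] (M : DFA Unit σ),
      (∀ i : ℕ, Even i → List.replicate (i * 2 ^ k) () ∈ M.accepts) →
      (∀ i : ℕ, Odd i → 0 < i → List.replicate (i * 2 ^ k) () ∉ M.accepts) →
      2 ^ (k + 1) ≤ Fintype.card σ) := by
  refine ⟨⟨cyclicDFA (2 ^ (k + 1)), fun i hi => ?_, fun i hi _ => ?_⟩, fun σ _ M hyes hno => ?_⟩
  · rw [replicate_mem_accepts_cyclicDFA, pow_succ']
    exact mul_dvd_mul_right hi.two_dvd _
  · rw [replicate_mem_accepts_cyclicDFA, pow_succ', Nat.mul_dvd_mul_iff_right (by positivity)]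
    exact hi.not_two_dvd_nat
  · by_contra! hcard
    obtain ⟨a, p, hp, hpc, hper⟩ :=
      Function.exists_isPeriodicPt_iterate (fun s => M.step s ()) M.start
    obtain ⟨m, hm, c, hc⟩ := Nat.exists_odd_mul_two_pow_of_lt hp (hpc.trans_lt hcard)
    have ha : a ≤ 2 * a * 2 ^ k := by nlinarith [Nat.one_le_two_pow (n := k)]
    obtain ⟨d, hd⟩ := Nat.exists_eq_add_of_le ha
    have hloop := (hper.mul_const c).apply_iterate d
    rw [Function.IsPeriodicPt, Function.IsFixedPt, ← Function.iterate_add_apply,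
      ← Function.iterate_add_apply, ← Function.iterate_add_apply, add_assoc, add_comm d a, ← hd,
      ← hc, ← add_mul] at hloop
    have hodd : Odd (m + 2 * a) := hm.add_even (even_two_mul a)
    apply hno (m + 2 * a) hodd hodd.pos
    rw [DFA.mem_accepts, DFA.eval_replicate_unit, hloop, ← DFA.eval_replicate_unit]
    exact hyes _ (even_two_mul a)
end

section
/- Let k and l be positive integers and N = 2^k·(2l+1). There exists a deterministic finite automaton over the one-letter alphabet with exactly 2^(k+1) states that solves the promise problem A^N exactly, i.e. it accepts a^(i·N) for every nonnegative even integer i and rejects a^(i·N) for every positive odd integer i. -/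
/-- The DFA over a one-letter alphabet that accepts the words of length divisible by `m`. -/
def cyclicCounter (m : ℕ) [NeZero m] : DFA Unit (Fin m) where
  step s _ := s + 1
  start := 0
  accept := {0}

theorem cyclicCounter_eval_replicate (m : ℕ) [NeZero m] (n : ℕ) :
    (cyclicCounter m).eval (List.replicate n ()) = Fin.ofNat m n := by
  induction n with
  | zero => rfl
  | succ n ih =>
    rw [List.replicate_succ', DFA.eval_append_singleton, ih]
    ext
    simp [cyclicCounter, Fin.val_add]

theorem replicate_mem_accepts_cyclicCounter (m : ℕ) [NeZero m] (n : ℕ) :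
    List.replicate n () ∈ (cyclicCounter m).accepts ↔ m ∣ n := by
  rw [DFA.mem_accepts, cyclicCounter_eval_replicate, Nat.dvd_iff_mod_eq_zero]
  simp [cyclicCounter, Fin.ext_iff]

theorem two_pow_succ_dvd_mul_iff_even (k l i : ℕ) :
    2 ^ (k + 1) ∣ i * (2 ^ k * (2 * l + 1)) ↔ Even i := by
  rw [pow_succ, mul_left_comm, Nat.mul_dvd_mul_iff_left (by positivity), ← even_iff_two_dvd]
  simp [Nat.even_mul]

/-- for `N = 2^k·(2l+1)`, there is a DFA over a one-letter alphabet
with exactly `2^(k+1)` states solving the promise problem `A^N` exactly. -/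
theorem dfa_solving_AN_exists
    (k l : ℕ) (hk : 0 < k) (hl : 0 < l) (N : ℕ) (hN : N = 2 ^ k * (2 * l + 1)) :
    ∃ M : DFA Unit (Fin (2 ^ (k + 1))),
      (∀ i : ℕ, Even i → List.replicate (i * N) () ∈ M.accepts) ∧
      (∀ i : ℕ, Odd i → 0 < i → List.replicate (i * N) () ∉ M.accepts) := by
  subst hN
  refine ⟨cyclicCounter (2 ^ (k + 1)), fun i hi => ?_, fun i hi _ => ?_⟩
  · rwa [replicate_mem_accepts_cyclicCounter, two_pow_succ_dvd_mul_iff_even]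
  · rwa [replicate_mem_accepts_cyclicCounter, two_pow_succ_dvd_mul_iff_even, Nat.not_even_iff_odd]
end

section
/- Let N be any positive integer (not necessarily a power of 2), and let U be the 2×2 real rotation matrix by angle θ = π/(2N). Then for every nonnegative integer i, the squared modulus of the first component of U^(i·N) applied to e₁ = (1,0)ᵀ equals 1 if i is even and 0 if i is odd. (Hence a two-state Moore–Crutchfield quantum finite automaton solves the promise problem A^N exactly for every positive integer N.) -/
open Real Matrix

/-- The `n`-th power of the rotation by `θ` is the rotation by `n * θ`. -/
lemma rotation_matrix_pow (θ : ℝ) (n : ℕ) :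
    !![cos θ, -sin θ; sin θ, cos θ] ^ n =
      !![cos (n * θ), -sin (n * θ); sin (n * θ), cos (n * θ)] := by
  induction n with
  | zero => simp [Matrix.one_fin_two]
  | succ n ih =>
    rw [pow_succ, ih, Matrix.mul_fin_two, Nat.cast_succ, add_one_mul, cos_add, sin_add]
    congr! 3 <;> ring_nf

/-- for any positive `N`, the two-state MCQFA with letter transition the
rotation by `π / (2N)` accepts `a^(i·N)` with probability exactly 1 when `i` is even
and exactly 0 when `i` is odd. -/
theorem mcqfa_solves_AN_exactly
    (N : ℕ) (hN : 0 < N)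
    (θ : ℝ) (hθ : θ = Real.pi / (2 * N))
    (U : Matrix (Fin 2) (Fin 2) ℝ)
    (hU : U = !![Real.cos θ, -Real.sin θ; Real.sin θ, Real.cos θ]) :
    ∀ i : ℕ, (((U ^ (i * N)).mulVec ![1, 0]) 0) ^ 2 = if Even i then 1 else 0 := by
  intro i
  have hN' : (N : ℝ) ≠ 0 := by positivity
  have angle : ((i * N : ℕ) : ℝ) * θ = i * (π / 2) := by
    rw [hθ]
    push_cast
    field_simp
  have component : ((U ^ (i * N)).mulVec ![1, 0]) 0 = cos (i * (π / 2)) := by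
    rw [hU, rotation_matrix_pow, angle]
    simp [Matrix.mulVec, dotProduct]
  rw [component]
  split_ifs with h
  · obtain ⟨k, rfl⟩ := h
    rw [show ((k + k : ℕ) : ℝ) * (π / 2) = k * π by push_cast; ring, cos_nat_mul_pi,
      ← pow_mul, mul_comm, pow_mul]
    simp
  · obtain ⟨k, rfl⟩ := Nat.not_even_iff_odd.mp h
    rw [show ((2 * k + 1 : ℕ) : ℝ) * (π / 2) = k * π + π / 2 by push_cast; ring,
      cos_add_pi_div_two, sin_nat_mul_pi]
    simp
end

section
/- Let N be a positive integer and let M be a deterministic finite automaton over a one-letter alphabet with finitely many states that accepts a^(i·N) for every nonnegative even integer i and rejects a^(i·N) for every positive odd integer i. Let t be any eventual period of M, i.e. 0 < t and there exists n₀ such that for all n ≥ n₀ the state of M after n letters equals its state after n + t letters. Then there is no nonnegative integer i with 2N·i ≡ N (mod t). -/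
/-- A sequence with period `t` from `n₀` on agrees at indices past `n₀` congruent modulo `t`. -/
theorem eq_of_modEq_of_eventually_periodic {α : Type*} {f : ℕ → α} {n₀ t : ℕ}
    (hf : ∀ n, n₀ ≤ n → f n = f (n + t)) {a b : ℕ} (ha : n₀ ≤ a) (hb : n₀ ≤ b)
    (hab : a ≡ b [MOD t]) : f a = f b := by
  have add_mul (n : ℕ) (hn : n₀ ≤ n) (k : ℕ) : f n = f (n + t * k) := by
    induction k with
    | zero => simp
    | succ k ih => rw [ih, hf _ (by omega), Nat.mul_succ, Nat.add_assoc]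
  wlog hle : a ≤ b generalizing a b
  · exact (this hb ha hab.symm (by omega)).symm
  obtain ⟨k, hk⟩ := (Nat.modEq_iff_dvd' hle).mp hab
  rw [add_mul a ha k, ← hk, Nat.add_sub_cancel' hle]

/-- if a unary DFA solves the promise problem `A^N` exactly and `t` is
an eventual period of the DFA, then no `i` satisfies `2N·i ≡ N (mod t)`. -/
theorem no_reachable_N_of_solves_AN
    (N : ℕ) (hN : 0 < N) (σ : Type) [Fintype σ] (M : DFA Unit σ)
    (h_yes : ∀ i : ℕ, Even i → List.replicate (i * N) () ∈ M.accepts)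
    (h_no : ∀ i : ℕ, Odd i → 0 < i → List.replicate (i * N) () ∉ M.accepts)
    (t : ℕ) (ht : 0 < t)
    (hper : ∃ n₀ : ℕ, ∀ n : ℕ, n₀ ≤ n →
      M.eval (List.replicate n ()) = M.eval (List.replicate (n + t) ())) :
    ¬ ∃ i : ℕ, 2 * N * i ≡ N [MOD t] := by
  rintro ⟨i, hi⟩
  obtain ⟨n₀, hper⟩ := hper
  have hmod : 2 * (n₀ + i) * N ≡ (2 * n₀ + 1) * N [MOD t] := by
    convert hi.add_left (2 * n₀ * N) using 1 <;> ring
  have heval := eq_of_modEq_of_eventually_periodic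
    (f := fun n => M.eval (List.replicate n ())) hper (by nlinarith) (by nlinarith) hmod
  refine h_no (2 * n₀ + 1) (odd_two_mul_add_one n₀) (Nat.succ_pos _) ?_
  have hyes := h_yes (2 * (n₀ + i)) (even_two_mul _)
  rw [DFA.mem_accepts] at hyes ⊢
  exact heval ▸ hyes
end
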